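/- arXiv:1905.10277 — 2 statements merged into one kernel-verified Lean document; each statement's English description precedes it below -/
import Mathlib

section
/- For monoids M and N (in universe u), the categories of right M-sets and right N-sets are equivalent if and only if the Karoubi envelopes of the corresponding one-object categories are equivalent: Nonempty (PSh(M) ≌ PSh(N)) ↔ Nonempty (Karoubi (SingleObj M) ≌ Karoubi (SingleObj N)). -/
open CategoryTheory CategoryTheory.Idempotents

universe u

/-- The category of right `M`-sets, realized as presheaves on the one-object category
associated to the monoid `M`. -/
abbrev PSh (M : Type u) [Monoid M] : Type (u + 1) :=
  (SingleObj M)ᵒᵖ ⥤ Type u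

open CategoryTheory.Limits

section Helpers

universe v w w' v'

/-- A family of maps is jointly epimorphic. -/
def JEpi {E : Type w} [Category.{v} E] {I : Type u} {Y : E} (X : I → E) (f : ∀ i, X i ⟶ Y) : Prop :=
  ∀ (Z : E) (a b : Y ⟶ Z), (∀ i, f i ≫ a = f i ≫ b) → a = b

/-- Connected projective objects. -/
def ConnProj {E : Type w} [Category.{v} E] (P : E) : Prop :=
  ∀ (I : Type u) (Y : E) (X : I → E) (f : ∀ i, X i ⟶ Y), JEpi.{u} X f →
    ∀ g : P ⟶ Y, ∃ (i : I) (h : P ⟶ X i), h ≫ f i = g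

theorem ConnProj.map {E : Type w} [Category.{v} E] {F : Type w'} [Category.{v'} F] (e : E ≌ F)
    {P : E} (hP : ConnProj.{u} P) : ConnProj.{u} (e.functor.obj P) := by
  intro I Y X f hf g
  obtain ⟨i, h, hh⟩ := hP I (e.inverse.obj Y) (fun i => e.inverse.obj (X i))
    (fun i => e.inverse.map (f i)) (by
      intro Z a b hab
      apply (e.symm.toAdjunction.homEquiv Y Z).injective
      apply hf
      intro i
      have := congrArg (e.symm.toAdjunction.homEquiv (X i) Z) (hab i)
      exact (e.symm.toAdjunction.homEquiv_naturality_left (f i) a).symm.trans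
        (this.trans (e.symm.toAdjunction.homEquiv_naturality_left (f i) b)))
    (e.toAdjunction.homEquiv P Y g)
  refine ⟨i, (e.toAdjunction.homEquiv P (X i)).symm h, ?_⟩
  rw [← e.toAdjunction.homEquiv_naturality_right_symm, hh, Equiv.symm_apply_apply]

theorem jepi_surj {K : Type u} [SmallCategory K] {I : Type u} {Y : Kᵒᵖ ⥤ Type u}
    (X : I → (Kᵒᵖ ⥤ Type u)) (f : ∀ i, X i ⟶ Y) (hf : JEpi.{u} X f) (k : Kᵒᵖ) (y : Y.obj k) :
    ∃ (i : I) (x : (X i).obj k), (f i).app k x = y := by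
  have hepi : Epi (Sigma.desc f) := ⟨fun a b hab => hf _ a b fun i => by
    have := congrArg (fun t => Sigma.ι X i ≫ t) hab
    simpa using this⟩
  have h2 : Epi ((Sigma.desc f).app k) := inferInstance
  obtain ⟨z, hz⟩ := (epi_iff_surjective _).1 h2 y
  obtain ⟨⟨i⟩, x, hx⟩ := Types.jointly_surjective_of_isColimit
    (isColimitOfPreserves ((evaluation Kᵒᵖ (Type u)).obj k)
      (colimit.isColimit (Discrete.functor X))) z
  refine ⟨i, x, ?_⟩
  have h3 : (Sigma.ι X i).app k x = z := hx
  rw [← hz, ← h3]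
  have h4 : Sigma.ι X i ≫ Sigma.desc f = f i := by simp
  rw [← h4]
  rfl

theorem connProj_yoneda {K : Type u} [SmallCategory K] (k : K) :
    ConnProj.{u} (yoneda.obj k) := by
  intro I Y X f hf g
  obtain ⟨i, x, hx⟩ := jepi_surj X f hf (Opposite.op k) (yonedaEquiv g)
  refine ⟨i, yonedaEquiv.symm x, ?_⟩
  apply yonedaEquiv.injective
  rw [yonedaEquiv_comp, Equiv.apply_symm_apply, hx]

theorem essImage_of_connProj {K : Type u} [SmallCategory K] [IsIdempotentComplete K]
    {P : Kᵒᵖ ⥤ Type u} (hP : ConnProj.{u} P) : (yoneda (C := K)).essImage P := by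
  obtain ⟨⟨k, x⟩, s, hs⟩ := hP (Σ k : K, P.obj (Opposite.op k)) P (fun j => yoneda.obj j.1)
    (fun j => yonedaEquiv.symm j.2) (by
      intro Z a b hab
      ext k y
      have := congrArg yonedaEquiv (hab ⟨k.unop, y⟩)
      rw [yonedaEquiv_comp, yonedaEquiv_comp, Equiv.apply_symm_apply] at this
      exact this) (𝟙 P)
  set r := yonedaEquiv.symm x with hr
  dsimp at s r hs
  obtain ⟨Y, i, e, h1, h2⟩ := IsIdempotentComplete.idempotents_split k
    (yoneda.preimage (r ≫ s)) (by
      apply yoneda.map_injective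
      simp only [Functor.map_comp, Functor.map_preimage, Category.assoc]
      rw [reassoc_of% hs])
  have h3 : yoneda.map e ≫ yoneda.map i = r ≫ s := by
    rw [← Functor.map_comp, h2, Functor.map_preimage]
  have h4 : yoneda.map i ≫ yoneda.map e = 𝟙 _ := by
    rw [← Functor.map_comp, h1, CategoryTheory.Functor.map_id]
  refine ⟨Y, ⟨⟨yoneda.map i ≫ r, s ≫ yoneda.map e, ?_, ?_⟩⟩⟩
  · rw [Category.assoc, ← reassoc_of% h3, h4, Category.comp_id, h4]
  · rw [Category.assoc, reassoc_of% h3, hs, Category.comp_id, hs]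

theorem equiv_of_psh_equiv {K L : Type u} [SmallCategory K] [SmallCategory L]
    [IsIdempotentComplete K] [IsIdempotentComplete L]
    (e : (Kᵒᵖ ⥤ Type u) ≌ (Lᵒᵖ ⥤ Type u)) : Nonempty (K ≌ L) := by
  let F : K ⥤ (yoneda (C := L)).EssImageSubcategory :=
    ObjectProperty.lift _ (yoneda ⋙ e.functor)
      (fun k => essImage_of_connProj ((connProj_yoneda k).map e))
  have : F.EssSurj := ⟨fun X => by
    obtain ⟨l, ⟨φ⟩⟩ := X.property
    obtain ⟨k, ⟨ψ⟩⟩ := essImage_of_connProj ((connProj_yoneda l).map e.symm)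
    exact ⟨k, ⟨ObjectProperty.isoMk _
      (e.functor.mapIso ψ ≪≫ e.counitIso.app _ ≪≫ φ)⟩⟩⟩
  have : F.IsEquivalence := { }
  have : (yoneda (C := L)).toEssImage.IsEquivalence := { }
  exact ⟨F.asEquivalence.trans (yoneda (C := L)).toEssImage.asEquivalence.symm⟩

instance isIdempotentComplete_type : IsIdempotentComplete (Type u) :=
  (isIdempotentComplete_iff_hasEqualizer_of_id_and_idempotent _).2 fun _ _ _ => inferInstance

/-- Presheaves on a category and on its Karoubi envelope are equivalent. -/
noncomputable def pshKaroubi (C : Type w) [Category.{v} C] :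
    (Cᵒᵖ ⥤ Type u) ≌ ((Karoubi C)ᵒᵖ ⥤ Type u) :=
  Equivalence.unop <|
    ((Functor.leftOpRightOpEquiv C (Type u)).trans (karoubiUniversal C (Type u)ᵒᵖ)).trans
      (Functor.leftOpRightOpEquiv (Karoubi C) (Type u)).symm

end Helpers

/-- Two monoids have equivalent categories of right actions if and only if the Karoubi
envelopes (idempotent completions) of the corresponding one-object categories are
equivalent. -/
theorem psh_equiv_iff_karoubi_equiv (M N : Type u) [Monoid M] [Monoid N] :
    Nonempty (PSh M ≌ PSh N) ↔
      Nonempty (Karoubi (SingleObj M) ≌ Karoubi (SingleObj N)) := by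
  constructor
  · rintro ⟨e⟩
    exact equiv_of_psh_equiv
      (((pshKaroubi (SingleObj M)).symm.trans e).trans (pshKaroubi (SingleObj N)))
  · rintro ⟨e⟩
    exact ⟨((pshKaroubi (SingleObj M)).trans e.op.congrLeft).trans
      (pshKaroubi (SingleObj N)).symm⟩
end

section
/- Let M be a monoid in which every right-invertible element is invertible, i.e. for all a, b : M, a * b = 1 implies b * a = 1 (this holds in particular when M is commutative, a group, or left cancellative). Then Morita equivalence collapses to isomorphism at M: for every monoid N, if Nonempty (PSh(M) ≌ PSh(N)) then M and N are isomorphic as monoids. -/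
open CategoryTheory

universe u

open Opposite in
/-- A separator surjects (split) onto every representable. -/
lemma exists_split_of_isSeparator {C : Type} [Category.{u} C] (c : C) (G : Cᵒᵖ ⥤ Type u)
    (hG : IsSeparator G) :
    ∃ (r : G ⟶ yoneda.obj c) (s : yoneda.obj c ⟶ G), s ≫ r = 𝟙 _ := by
  let S : Sieve c :=
    { arrows := fun d f => ∃ (φ : G ⟶ yoneda.obj c) (y : G.obj (op d)), φ.app (op d) y = f
      downward_closed := by
        rintro Y Z f ⟨φ, y, rfl⟩ g
        exact ⟨φ, G.map g.op y, by simp [NatTrans.naturality_apply]⟩ }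
  let Ω : Cᵒᵖ ⥤ Type u := Functor.sieves C
  have key : (yonedaEquiv (F := Ω)).symm (S : Sieve c) = yonedaEquiv.symm (⊤ : Sieve c) := by
    apply hG.def
    intro φ
    ext d y
    have h1 : S.pullback (φ.app d y) = (⊤ : Sieve c).pullback (φ.app d y) := by
      rw [Sieve.pullback_top]
      exact S.pullback_eq_top_of_mem ⟨φ, y, rfl⟩
    exact h1
  have hS : S = ⊤ := yonedaEquiv.symm.injective key
  obtain ⟨φ, y, hy⟩ := Sieve.id_mem_iff_eq_top.2 hS
  refine ⟨φ, yonedaEquiv.symm y, ?_⟩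
  apply yonedaEquiv.injective
  rw [yonedaEquiv_comp, Equiv.apply_symm_apply, hy]
  rfl

lemma isSeparator_yoneda_star (M : Type u) [Monoid M] :
    IsSeparator (yoneda.obj (SingleObj.star M) : PSh M) := by
  rw [isSeparator_def]
  intro X Y f g h
  ext ⟨⟨⟩⟩ x
  have := congrArg yonedaEquiv (h (yonedaEquiv.symm x))
  rw [yonedaEquiv_comp, yonedaEquiv_comp, Equiv.apply_symm_apply] at this
  exact this

noncomputable def endYoneda (M : Type u) [Monoid M] :
    M ≃* End (yoneda.obj (SingleObj.star M) : PSh M) :=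
  (SingleObj.toEnd M).trans (Yoneda.fullyFaithful.mulEquivEnd _)

/-- If every right-invertible element of a monoid `M` is invertible (as holds when `M` is
commutative, a group, or left cancellative), then Morita equivalence collapses to
isomorphism at `M`: any monoid `N` whose category of right actions is equivalent to that
of `M` is isomorphic to `M`. -/
theorem morita_trivial_of_right_invertible_invertible (M : Type u) [Monoid M]
    (h : ∀ a b : M, a * b = 1 → b * a = 1) (N : Type u) [Monoid N]
    (hMN : Nonempty (PSh M ≌ PSh N)) : Nonempty (M ≃* N) := by
  obtain ⟨E⟩ := hMN
  let R : PSh M := yoneda.obj (SingleObj.star M)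
  let T : PSh N := yoneda.obj (SingleObj.star N)
  let Q : PSh M := E.inverse.obj T
  have hEnd : ∀ a b : R ⟶ R, a ≫ b = 𝟙 R → b ≫ a = 𝟙 R := by
    intro a b hab
    let e : M ≃* End R := endYoneda M
    have h1 : e.symm (b : End R) * e.symm (a : End R) = 1 := by
      rw [← map_mul]
      exact (congrArg e.symm hab).trans (map_one e.symm)
    have h2 := congrArg e (h _ _ h1)
    rw [map_mul, map_one, MulEquiv.apply_symm_apply, MulEquiv.apply_symm_apply] at h2
    exact h2
  obtain ⟨s, j, hjs⟩ : ∃ (s : Q ⟶ R) (j : R ⟶ Q), j ≫ s = 𝟙 R :=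
    exists_split_of_isSeparator _ Q ((isSeparator_yoneda_star N).of_equivalence E.symm)
  obtain ⟨r, i, hir⟩ : ∃ (r : E.functor.obj R ⟶ T) (i : T ⟶ E.functor.obj R), i ≫ r = 𝟙 T :=
    exists_split_of_isSeparator _ _ ((isSeparator_yoneda_star M).of_equivalence E)
  let r' : R ⟶ Q := E.unit.app R ≫ E.inverse.map r
  let i' : Q ⟶ R := E.inverse.map i ≫ E.unitInv.app R
  have hir' : i' ≫ r' = 𝟙 Q := by
    have : E.inverse.map i ≫ E.inverse.map r = 𝟙 _ := by rw [← Functor.map_comp, hir]; simp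
    simpa [i', r'] using this
  have h3 : (j ≫ i') ≫ (r' ≫ s) = 𝟙 R := by
    rw [Category.assoc, reassoc_of% hir', hjs]
  have h4 := hEnd _ _ h3
  have h5 : r' ≫ i' = 𝟙 R := by
    have h6 : (r' ≫ s ≫ j) ≫ i' = 𝟙 R := by simpa using h4
    have h7 : r' ≫ s ≫ j = r' := by
      calc r' ≫ s ≫ j = ((r' ≫ s ≫ j) ≫ i') ≫ r' := by simp [hir']
        _ = r' := by rw [h6, Category.id_comp]
    rwa [h7] at h6
  let α : R ≅ Q := ⟨r', i', h5, hir'⟩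
  exact ⟨(endYoneda M).trans (α.conj.trans
    ((E.fullyFaithfulInverse.mulEquivEnd T).symm.trans (endYoneda N).symm))⟩
end
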